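/- There is no permutation σ of {1,…,6} whose cycle type is (4, 2) (i.e., σ is a product of a disjoint 4-cycle and 2-cycle) such that the longest increasing subsequence of σ has length 2 and the longest decreasing subsequence of σ has length 3. -/

import Mathlib

open Equiv

/-- `s` is (the index set of) an increasing subsequence of the permutation `σ`. -/
def IsIncSubseq {n : ℕ} (σ : Perm (Fin n)) (s : Finset (Fin n)) : Prop :=
  ∀ i ∈ s, ∀ j ∈ s, i < j → σ i < σ j

/-- `s` is (the index set of) a decreasing subsequence of the permutation `σ`. -/
def IsDecSubseq {n : ℕ} (σ : Perm (Fin n)) (s : Finset (Fin n)) : Prop :=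
  ∀ i ∈ s, ∀ j ∈ s, i < j → σ j < σ i

/-- The cycle type of `σ`, counting each fixed point as a cycle of length `1`. -/
def fullCycleType {n : ℕ} (σ : Perm (Fin n)) : Multiset ℕ :=
  σ.cycleType + Multiset.replicate (n - σ.cycleType.sum) 1

theorem cycleType_eq_of_fullCycleType_eq {n : ℕ} {σ : Perm (Fin n)} {m : Multiset ℕ}
    (h : fullCycleType σ = m) (hm : 1 ∉ m) : σ.cycleType = m ∧ n ≤ σ.cycleType.sum := by
  unfold fullCycleType at h
  have hn : n - σ.cycleType.sum = 0 := by
    by_contra hne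
    exact hm (h ▸ Multiset.mem_add.2 (Or.inr (Multiset.mem_replicate.2 ⟨hne, rfl⟩)))
  rw [hn, Multiset.replicate_zero, add_zero] at h
  exact ⟨h, by omega⟩

theorem not_increasing_triple {n : ℕ} {σ : Perm (Fin n)}
    (h : ∀ s, IsIncSubseq σ s → s.card ≤ 2) {i j k : Fin n} (hij : i < j) (hjk : j < k) :
    ¬ (σ i < σ j ∧ σ j < σ k) := by
  rintro ⟨h₁, h₂⟩
  have hs : IsIncSubseq σ {i, j, k} := by
    intro a ha b hb hab
    simp only [Finset.mem_insert, Finset.mem_singleton] at ha hb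
    rcases ha with rfl | rfl | rfl <;> rcases hb with rfl | rfl | rfl <;> order
  have hc := h _ hs
  rw [Finset.card_eq_three.2 ⟨i, j, k, hij.ne, (hij.trans hjk).ne, hjk.ne, rfl⟩] at hc
  omega

theorem not_decreasing_quadruple {n : ℕ} {σ : Perm (Fin n)}
    (h : ∀ s, IsDecSubseq σ s → s.card ≤ 3) {i j k l : Fin n}
    (hij : i < j) (hjk : j < k) (hkl : k < l) :
    ¬ (σ j < σ i ∧ σ k < σ j ∧ σ l < σ k) := by
  rintro ⟨h₁, h₂, h₃⟩
  have hs : IsDecSubseq σ {i, j, k, l} := by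
    intro a ha b hb hab
    simp only [Finset.mem_insert, Finset.mem_singleton] at ha hb
    rcases ha with rfl | rfl | rfl | rfl <;> rcases hb with rfl | rfl | rfl | rfl <;> order
  have hc := h _ hs
  rw [Finset.card_insert_of_notMem, Finset.card_eq_three.2
    ⟨j, k, l, hjk.ne, (hjk.trans hkl).ne, hkl.ne, rfl⟩] at hc
  · omega
  · simp [hij.ne, (hij.trans hjk).ne, ((hij.trans hjk).trans hkl).ne]

/-- If the word `w` has no increasing triple and no decreasing quadruple, and its fourth iterate
is the identity, then it is an involution. -/
def InvolutiveIfAvoiding {n : ℕ} (w : Fin n → Fin n) : Prop :=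
  (∀ i, w (w (w (w i))) = i) →
  (∀ i j k, i < j ∧ j < k → ¬ (w i < w j ∧ w j < w k)) →
  (∀ i j k l, i < j ∧ j < k ∧ k < l →
    ¬ (w j < w i ∧ w k < w j ∧ w l < w k)) →
  ∀ i, w (w i) = i

instance {n : ℕ} (w : Fin n → Fin n) : Decidable (InvolutiveIfAvoiding w) := by
  unfold InvolutiveIfAvoiding
  infer_instance

theorem involutiveIfAvoiding_of_derangement :
    ∀ a : Fin 6, a ∉ [0] → ∀ b : Fin 6, b ∉ [1, a] → ∀ c : Fin 6, c ∉ [2, a, b] →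
    ∀ d : Fin 6, d ∉ [3, a, b, c] → ∀ e : Fin 6, e ∉ [4, a, b, c, d] →
    ∀ f : Fin 6, f ∉ [5, a, b, c, d, e] → InvolutiveIfAvoiding ![a, b, c, d, e, f] := by
  decide +kernel

/-- No permutation of `{1,…,6}` with cycle type `(4, 2)` has longest increasing
subsequence of length `2` and longest decreasing subsequence of length `3`. -/
theorem no_perm_cycleType_four_two_shape_two_two_two :
    ¬ ∃ σ : Perm (Fin 6),
      fullCycleType σ = {4, 2} ∧
      ((∃ s, IsIncSubseq σ s ∧ s.card = 2) ∧
        (∀ s, IsIncSubseq σ s → s.card ≤ 2)) ∧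
      ((∃ s, IsDecSubseq σ s ∧ s.card = 3) ∧
        (∀ s, IsDecSubseq σ s → s.card ≤ 3)) := by
  rintro ⟨σ, hσ, ⟨-, hinc⟩, -, hdec⟩
  obtain ⟨hct, hsum⟩ := cycleType_eq_of_fullCycleType_eq hσ (by decide)
  have hord : orderOf σ = 4 := by
    rw [← Perm.lcm_cycleType, hct]
    decide
  have hfix : ∀ i, σ i ≠ i := by
    rw [Perm.sum_cycleType] at hsum
    have huniv : σ.support = Finset.univ :=
      Finset.eq_univ_of_card _ (le_antisymm (Finset.card_le_univ _) (by simpa using hsum))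
    intro i
    exact Perm.mem_support.1 (huniv ▸ Finset.mem_univ i)
  have hpow : ∀ i, σ (σ (σ (σ i))) = i := fun i => by
    have h4 : σ ^ 4 = 1 := hord ▸ pow_orderOf_eq_one σ
    simpa [pow_succ] using Perm.congr_fun h4 i
  have hword : (![σ 0, σ 1, σ 2, σ 3, σ 4, σ 5] : Fin 6 → Fin 6) = σ := by
    ext i
    fin_cases i <;> rfl
  have hinv : ∀ i, σ (σ i) = i := by
    have h : InvolutiveIfAvoiding σ := by
      rw [← hword]
      apply involutiveIfAvoiding_of_derangement <;> simp [hfix]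
    exact h hpow (fun _ _ _ hi => not_increasing_triple hinc hi.1 hi.2)
      fun _ _ _ _ hi => not_decreasing_quadruple hdec hi.1 hi.2.1 hi.2.2
  have h2 : σ ^ 2 = 1 := Perm.ext fun i => by simpa [pow_succ] using hinv i
  have := orderOf_dvd_of_pow_eq_one h2
  rw [hord] at this
  omega
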